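/- arXiv:2512.19028 — 5 statements merged into one kernel-verified Lean document; each statement's English description precedes it below -/
import Mathlib

section
/- For all v = (p,s) and w = (r,u) in (ZMod N)², the symmetric Weyl elements satisfy the Frohman–Gelca product-to-sum rule B(v) * B(w) = t^(ω(v,w)) • B(v+w) + t^(−ω(v,w)) • B(v−w). -/
open Matrix

/-- The root of unity `t = exp(2πi/N)`. -/
noncomputable def t (N : ℕ) : ℂ := Complex.exp (2 * Real.pi * Complex.I / N)

/-- The power `t^k` for `k : ZMod N`, via the canonical lift `k.val`
(well-defined since `t^N = 1`). -/
noncomputable def tpow (N : ℕ) (k : ZMod N) : ℂ := t N ^ k.val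

/-- The phased translation (Weyl) matrix `W(p,s)`: its `((r',u'),(r,u))` entry is
`t^(p*u − s*r)` if `(r',u') = (r+p, u+s)` and `0` otherwise. -/
noncomputable def W (N : ℕ) (v : ZMod N × ZMod N) :
    Matrix ((ZMod N) × (ZMod N)) ((ZMod N) × (ZMod N)) ℂ :=
  fun x y => if x = (y.1 + v.1, y.2 + v.2) then tpow N (v.1 * y.2 - v.2 * y.1) else 0

/-- The symmetric Weyl element `B(p,s) = W(p,s) + W(−p,−s)`, the image of the skein
generator `(p,s)_T` under the Frohman–Gelca embedding. -/
noncomputable def B (N : ℕ) (v : ZMod N × ZMod N) :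
    Matrix ((ZMod N) × (ZMod N)) ((ZMod N) × (ZMod N)) ℂ :=
  W N v + W N (-v)

/-- The symplectic form `ω((p,s),(r,u)) = pu − sr` on `(ZMod N)²`. -/
def omegaForm (N : ℕ) (v w : ZMod N × ZMod N) : ZMod N :=
  v.1 * w.2 - v.2 * w.1

theorem t_pow_self (N : ℕ) [NeZero N] : t N ^ N = 1 :=
  (Complex.isPrimitiveRoot_exp N (NeZero.ne N)).pow_eq_one

theorem tpow_add (N : ℕ) [NeZero N] (a b : ZMod N) :
    tpow N (a + b) = tpow N a * tpow N b := by
  rw [tpow, tpow, tpow, ZMod.val_add, ← pow_add, ← pow_eq_pow_mod _ (t_pow_self N)]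

/-- The multiplication rule of the non-commutative torus. -/
theorem W_mul_W (N : ℕ) [NeZero N] (v w : ZMod N × ZMod N) :
    W N v * W N w = tpow N (omegaForm N v w) • W N (v + w) := by
  ext x y
  rw [Matrix.mul_apply, Finset.sum_eq_single (y.1 + w.1, y.2 + w.2)]
  · have hx : (y.1 + w.1 + v.1, y.2 + w.2 + v.2) =
        (y.1 + (v + w).1, y.2 + (v + w).2) := by
      ext <;> simp <;> ring
    simp only [W, Matrix.smul_apply, smul_eq_mul, if_true, hx]
    split_ifs
    · rw [← tpow_add, ← tpow_add]
      congr 1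
      simp only [omegaForm, Prod.fst_add, Prod.snd_add]
      ring
    · simp
  · intro z _ hz
    simp [W, hz]
  · simp

/-- the Frohman–Gelca product-to-sum rule
`B(v) * B(w) = t^(ω(v,w)) • B(v+w) + t^(−ω(v,w)) • B(v−w)`. -/
theorem frohman_gelca_product (N : ℕ) [NeZero N] (hN : 3 ≤ N) (hNodd : Odd N)
    (v w : ZMod N × ZMod N) :
    B N v * B N w =
      tpow N (omegaForm N v w) • B N (v + w) +
      tpow N (-(omegaForm N v w)) • B N (v - w) := by
  have neg_right : omegaForm N v (-w) = -omegaForm N v w := by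
    simp only [omegaForm, Prod.fst_neg, Prod.snd_neg]; ring
  have neg_left : omegaForm N (-v) w = -omegaForm N v w := by
    simp only [omegaForm, Prod.fst_neg, Prod.snd_neg]; ring
  have neg_both : omegaForm N (-v) (-w) = omegaForm N v w := by
    simp only [omegaForm, Prod.fst_neg, Prod.snd_neg]; ring
  simp only [B, add_mul, mul_add, W_mul_W, neg_right, neg_left, neg_both, smul_add,
    sub_eq_add_neg v w, neg_add, neg_neg]
  abel
end

section
/- For odd N ≥ 3, the ℂ-linear span of the set of matrices { B(p,s) : (p,s) ∈ (ZMod N)² } inside Matrix ((ZMod N) × (ZMod N)) ((ZMod N) × (ZMod N)) ℂ is a subspace of dimension (N² + 1)/2. -/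
open Matrix

section Symmetrization

variable {G : Type*} [AddCommGroup G] [Fintype G] [DecidableEq G]

/-- Averaging a function over the involution `x ↦ -x` is a projection onto the span of the
symmetrized indicator functions. -/
theorem isProj_symmetrize :
    LinearMap.IsProj
      (Submodule.span ℂ (Set.range fun v : G ↦
        (Pi.single v 1 + Pi.single (-v) 1 : G → ℂ)))
      ((2⁻¹ : ℂ) • (LinearMap.id + LinearMap.funLeft ℂ ℂ (Neg.neg : G → G))) := by
  have funLeft_single (v : G) : LinearMap.funLeft ℂ ℂ (Neg.neg : G → G) (Pi.single v 1) =
      Pi.single (-v) 1 := by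
    ext x
    simp [LinearMap.funLeft_apply, Pi.single_apply, neg_eq_iff_eq_neg]
  constructor
  · intro f
    rw [← (Pi.basisFun ℂ G).sum_repr f, map_sum]
    refine Submodule.sum_mem _ fun v _ ↦ ?_
    rw [map_smul]
    refine Submodule.smul_mem _ _ ?_
    rw [Pi.basisFun_apply, LinearMap.smul_apply, LinearMap.add_apply, funLeft_single]
    exact Submodule.smul_mem _ _ (Submodule.subset_span ⟨v, rfl⟩)
  · intro f hf
    induction hf using Submodule.span_induction with
    | mem x hx =>
      obtain ⟨v, rfl⟩ := hx
      simp only [LinearMap.smul_apply, LinearMap.add_apply, LinearMap.id_apply, map_add,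
        funLeft_single, neg_neg]
      module
    | zero => simp
    | add x y _ _ hx hy => rw [map_add, hx, hy]
    | smul a x _ hx => rw [map_smul, hx]

/-- The pullback along negation has trace one when zero is the only element equal to its
negative. -/
theorem trace_funLeft_neg (h : ∀ v : G, -v = v → v = 0) :
    LinearMap.trace ℂ (G → ℂ) (LinearMap.funLeft ℂ ℂ (Neg.neg : G → G)) = 1 := by
  have fixed_iff (v : G) : -v = v ↔ v = 0 := ⟨h v, by rintro rfl; simp⟩
  rw [LinearMap.trace_eq_matrix_trace ℂ (Pi.basisFun ℂ G)]
  simp [Matrix.trace, LinearMap.funLeft_apply, Pi.single_apply,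
    fixed_iff]

theorem finrank_span_symmetrize {V : Type*} [AddCommGroup V] [Module ℂ V]
    (h : ∀ v : G, -v = v → v = 0) {w : G → V} (hw : LinearIndependent ℂ w) :
    2 * Module.finrank ℂ (Submodule.span ℂ (Set.range fun v ↦ w v + w (-v))) =
      Fintype.card G + 1 := by
  have span_eq : Submodule.span ℂ (Set.range fun v ↦ w v + w (-v)) =
      (Submodule.span ℂ (Set.range fun v : G ↦
        (Pi.single v 1 + Pi.single (-v) 1 : G → ℂ))).map (Fintype.linearCombination ℂ w) := by
    rw [Submodule.map_span, ← Set.range_comp]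
    congr 2
    ext v
    simp [Fintype.linearCombination_apply_single]
  rw [span_eq, ← (Submodule.equivMapOfInjective _
    (hw.fintypeLinearCombination_injective) _).finrank_eq]
  have trace_eq := (isProj_symmetrize (G := G)).trace
  rw [map_smul, map_add, trace_funLeft_neg h, LinearMap.trace_id, Module.finrank_pi] at trace_eq
  have : (2 : ℂ) * Module.finrank ℂ (Submodule.span ℂ (Set.range fun v : G ↦
        (Pi.single v 1 + Pi.single (-v) 1 : G → ℂ))) = Fintype.card G + 1 := by
    rw [← trace_eq, smul_eq_mul]
    ring
  exact_mod_cast this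

end Symmetrization

theorem linearIndependent_W (N : ℕ) [NeZero N] : LinearIndependent ℂ (W N) := by
  let column : Matrix (ZMod N × ZMod N) (ZMod N × ZMod N) ℂ →ₗ[ℂ] (ZMod N × ZMod N → ℂ) :=
    { toFun := fun M x ↦ M x 0, map_add' := fun _ _ ↦ rfl, map_smul' := fun _ _ ↦ rfl }
  have column_W : column ∘ W N = Pi.basisFun ℂ (ZMod N × ZMod N) := by
    ext v x
    change W N v x 0 = _
    simp [W, tpow, Pi.single_apply]
  refine LinearIndependent.of_comp column ?_
  rw [column_W]
  exact (Pi.basisFun ℂ _).linearIndependent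

theorem ZMod.prod_eq_zero_of_neg_eq_self {N : ℕ} (hN : Odd N) (v : ZMod N × ZMod N)
    (hv : -v = v) : v = 0 :=
  Prod.ext (by_contra fun h ↦ ZMod.ne_neg_self hN h (congrArg Prod.fst hv).symm)
    (by_contra fun h ↦ ZMod.ne_neg_self hN h (congrArg Prod.snd hv).symm)

/-- the ℂ-linear span of `{ B(p,s) : (p,s) ∈ (ZMod N)² }` inside the
matrix algebra has dimension `(N² + 1)/2`. -/
theorem skein_span_dimension (N : ℕ) [NeZero N] (hN : 3 ≤ N) (hNodd : Odd N) :
    Module.finrank ℂ (Submodule.span ℂ (Set.range (B N))) = (N ^ 2 + 1) / 2 := by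
  have key := finrank_span_symmetrize (ZMod.prod_eq_zero_of_neg_eq_self hNodd)
    (linearIndependent_W N)
  rw [Fintype.card_prod, ZMod.card, ← sq] at key
  change Module.finrank ℂ (Submodule.span ℂ (Set.range fun v ↦ W N v + W N (-v))) = _
  omega
end

section
/- Let N ≥ 3 be odd, t = exp(2πi/N), and let ρS be the matrix indexed by (ZMod N)² with ((r,u),(p,s)) entry (1/N)·t^(2(pu−sr)). Then ρS is unitary (ρS * ρSᴴ = 1) and satisfies ρS⁴ = 1. -/
open Matrix

/-- The Weil representation of the modular generator `S`:
entry at `((r,u),(p,s))` is `(1/N)·t^(2(pu−sr))`. -/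
noncomputable def rhoS (N : ℕ) :
    Matrix ((ZMod N) × (ZMod N)) ((ZMod N) × (ZMod N)) ℂ :=
  fun x y => (1 / (N : ℂ)) * tpow N (2 * (y.1 * x.2 - y.2 * x.1))

theorem tpow_eq_stdAddChar (N : ℕ) [NeZero N] (k : ZMod N) : tpow N k = ZMod.stdAddChar k := by
  rw [ZMod.stdAddChar_apply, ZMod.toCircle_apply, tpow, t, ← Complex.exp_nat_mul]
  congr 1
  ring

theorem rhoS_isHermitian (N : ℕ) [NeZero N] : (rhoS N)ᴴ = rhoS N := by
  ext x y
  simp only [conjTranspose_apply, rhoS, tpow_eq_stdAddChar, star_mul', star_div₀, star_one,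
    star_natCast]
  rw [← starRingEnd_apply, ← AddChar.map_neg_eq_conj]
  congr 2
  ring

theorem sum_stdAddChar_two_mul {N : ℕ} [NeZero N] (hN : Odd N) (a b : ZMod N) :
    ∑ c, ZMod.stdAddChar (c * (2 * (a - b))) = if a = b then (N : ℂ) else 0 := by
  have h2 : IsUnit (2 : ZMod N) := by
    exact_mod_cast (ZMod.isUnit_iff_coprime 2 N).2 hN.coprime_two_left
  rw [AddChar.sum_mulShift _ (ZMod.isPrimitive_stdAddChar N)]
  simp [h2.mul_right_eq_zero, sub_eq_zero, ZMod.card]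

theorem rhoS_mul_self {N : ℕ} [NeZero N] (hN : Odd N) : rhoS N * rhoS N = 1 := by
  have hN0 : (N : ℂ) ≠ 0 := NeZero.ne _
  ext x z
  have key (y : ZMod N × ZMod N) : rhoS N x y * rhoS N y z = 1 / (N : ℂ) ^ 2 *
      (ZMod.stdAddChar (y.1 * (2 * (x.2 - z.2))) * ZMod.stdAddChar (y.2 * (2 * (z.1 - x.1)))) := by
    simp only [rhoS, tpow_eq_stdAddChar]
    rw [mul_mul_mul_comm, ← AddChar.map_add_eq_mul, ← AddChar.map_add_eq_mul]
    congr 1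
    · field_simp
    · congr 1
      ring
  simp only [mul_apply, key]
  rw [← Finset.mul_sum, Fintype.sum_prod_type]
  dsimp only
  rw [← Finset.sum_mul_sum,
    sum_stdAddChar_two_mul hN, sum_stdAddChar_two_mul hN, one_apply]
  by_cases h1 : z.1 = x.1 <;> by_cases h2 : x.2 = z.2 <;>
    simp [h1, h2, Prod.ext_iff, eq_comm (a := x.1)]
  field_simp

/-- `ρ(S)` is unitary and satisfies `ρ(S)⁴ = 1`. -/
theorem rhoS_unitary_order_four (N : ℕ) [NeZero N] (hN : 3 ≤ N) (hNodd : Odd N) :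
    rhoS N * (rhoS N)ᴴ = 1 ∧ (rhoS N) ^ 4 = 1 := by
  have h := rhoS_mul_self hNodd
  refine ⟨by rw [rhoS_isHermitian, h], ?_⟩
  rw [show 4 = 2 * 2 from rfl, pow_mul, pow_two (rhoS N), h, one_pow]
end

section
/- For any finite sequence v_1, …, v_m ∈ (ZMod N)², the ordered matrix product B(v_1) * B(v_2) * ⋯ * B(v_m) equals the sum over all sign assignments ε ∈ {−1, +1}^m of t^(Σ_{i<j} ε_i ε_j ω(v_i, v_j)) • W(Σ_{i=1}^m ε_i v_i); i.e. the m-fold skein product expands as an Ising-like signed sum of 2^m Weyl elements with quadratic symplectic phases. -/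
open Matrix

theorem tpow_zero (N : ℕ) : tpow N 0 = 1 := by
  simp [tpow]

theorem W_zero (N : ℕ) : W N 0 = 1 := by
  ext x y
  simp [W, Matrix.one_apply, tpow_zero]

theorem B_eq_sum_units (N : ℕ) (v : ZMod N × ZMod N) :
    B N v = ∑ e : ℤˣ, W N ((e : ℤ) • v) := by
  rw [UnitsInt.univ, Finset.sum_pair (by decide)]
  simp [B]

theorem omegaForm_sum_zsmul {ι : Type*} (N : ℕ) (s : Finset ι) (a : ι → ℤ) (b : ℤ)
    (v : ι → ZMod N × ZMod N) (w : ZMod N × ZMod N) :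
    omegaForm N (∑ i ∈ s, a i • v i) (b • w) =
      ∑ i ∈ s, ((a i * b : ℤ) : ZMod N) * omegaForm N (v i) w := by
  simp only [omegaForm, Prod.fst_sum, Prod.snd_sum, Prod.smul_fst, Prod.smul_snd,
    Finset.sum_mul, ← Finset.sum_sub_distrib, Int.cast_mul]
  refine Finset.sum_congr rfl fun i _ => ?_
  simp only [zsmul_eq_mul]
  ring

/-- the ordered skein product `B(v₁) ⋯ B(v_m)` expands as the signed
(Ising-like) sum over all `2^m` sign assignments `ε ∈ {±1}^m` of
`t^(Σ_{i<j} εᵢεⱼ ω(vᵢ,vⱼ)) • W(Σ εᵢ vᵢ)`. Sign assignments are encoded as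
functions `ε : Fin m → ℤˣ` (the units of `ℤ` are exactly `{−1, +1}`). -/
theorem skein_product_expansion (N : ℕ) [NeZero N] (hN : 3 ≤ N) (hNodd : Odd N)
    (m : ℕ) (v : Fin m → ZMod N × ZMod N) :
    (List.ofFn fun i => B N (v i)).prod =
      ∑ ε : Fin m → ℤˣ,
        tpow N (∑ j : Fin m, ∑ i ∈ Finset.Iio j,
            ((((ε i : ℤ) * (ε j : ℤ)) : ℤ) : ZMod N) * omegaForm N (v i) (v j)) •
          W N (∑ i : Fin m, (ε i : ℤ) • v i) := by
  clear hN hNodd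
  induction m with
  | zero => simp [tpow_zero, W_zero]
  | succ m ih =>
    rw [List.ofFn_succ', List.prod_concat, ih fun i => v i.castSucc, B_eq_sum_units,
      Finset.sum_mul_sum, ← (Fin.snocEquiv fun _ : Fin (m + 1) => ℤˣ).sum_comp,
      Fintype.sum_prod_type_right]
    refine Finset.sum_congr rfl fun ε _ => Finset.sum_congr rfl fun e _ => ?_
    rw [smul_mul_assoc, W_mul_W, smul_smul, ← tpow_add, omegaForm_sum_zsmul]
    simp [Fin.sum_univ_castSucc, Fin.snocEquiv, ← Fin.map_castSuccEmb_Iio, Fin.Iio_last_eq_map]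
end

section
/- Let a_1, …, a_m, z be integers with images in ZMod N. The matrix entry of the product ∏_{i=1}^m B((a_i, 0)) at row index ((z,0)) and column index ((0,0)) equals the number of sign assignments ε ∈ {−1, +1}^m with Σ_{i=1}^m ε_i a_i ≡ z (mod N), as a complex number. (The factors B((a_i,0)) pairwise commute, so the product is unambiguous.) -/
open Matrix

theorem W_colinear_mul_apply (N : ℕ) [NeZero N] (p r : ZMod N)
    (M : Matrix (ZMod N × ZMod N) (ZMod N × ZMod N) ℂ) (y : ZMod N × ZMod N) :
    (W N (p, 0) * M) (r, 0) y = M (r - p, 0) y := by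
  rw [Matrix.mul_apply, Finset.sum_eq_single (r - p, 0)]
  · simp [W, tpow_zero]
  · rintro ⟨x, u⟩ - hne
    rw [W, if_neg, zero_mul]
    intro h
    simp only [Prod.mk.injEq, add_zero] at h
    exact hne (by simp [h.1, ← h.2])
  · simp

theorem B_colinear_mul_apply (N : ℕ) [NeZero N] (p r : ZMod N)
    (M : Matrix (ZMod N × ZMod N) (ZMod N × ZMod N) ℂ) (y : ZMod N × ZMod N) :
    (B N (p, 0) * M) (r, 0) y = M (r - p, 0) y + M (r + p, 0) y := by
  have hneg : (-(p, 0) : ZMod N × ZMod N) = (-p, 0) := by simp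
  rw [B, hneg, Matrix.add_mul, Matrix.add_apply, W_colinear_mul_apply,
    W_colinear_mul_apply, sub_neg_eq_add]

theorem card_signs_succ (N m : ℕ) (a : Fin (m + 1) → ℤ) (z : ZMod N) :
    (Finset.univ.filter (fun ε : Fin (m + 1) → ℤˣ =>
        ((∑ i, (ε i : ℤ) * a i : ℤ) : ZMod N) = z)).card =
      (Finset.univ.filter (fun ε : Fin m → ℤˣ =>
        ((∑ i, (ε i : ℤ) * a i.succ : ℤ) : ZMod N) = z - a 0)).card +
      (Finset.univ.filter (fun ε : Fin m → ℤˣ =>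
        ((∑ i, (ε i : ℤ) * a i.succ : ℤ) : ZMod N) = z + a 0)).card := by
  simp only [Finset.card_filter]
  rw [← (Fin.consEquiv fun _ => ℤˣ).sum_comp, Fintype.sum_prod_type,
    UnitsInt.univ, Finset.sum_pair (by decide)]
  congr 1 <;> refine Finset.sum_congr rfl fun ε _ => if_congr ?_ rfl rfl
  · simp [Fin.consEquiv, Fin.sum_univ_succ, eq_sub_iff_add_eq']
  · simp [Fin.consEquiv, Fin.sum_univ_succ, neg_add_eq_iff_eq_add, add_comm]

theorem colinear_prod_apply (N : ℕ) [NeZero N] (m : ℕ) (a : Fin m → ℤ) (z : ZMod N) :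
    (List.ofFn fun i => B N ((a i : ZMod N), 0)).prod (z, 0) (0, 0) =
      ((Finset.univ.filter (fun ε : Fin m → ℤˣ =>
        ((∑ i, (ε i : ℤ) * a i : ℤ) : ZMod N) = z)).card : ℂ) := by
  induction m generalizing z with
  | zero => by_cases h : z = 0 <;> simp [h, eq_comm]
  | succ m ih =>
    rw [List.ofFn_succ, List.prod_cons, B_colinear_mul_apply, ih, ih, card_signs_succ,
      Nat.cast_add]

/-- the matrix entry of the colinear skein product `∏ᵢ B((aᵢ,0))` at row
`((z,0))` and column `((0,0))` equals the number of sign assignments `ε ∈ {±1}^m` with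
`Σ εᵢ aᵢ ≡ z (mod N)`. Sign assignments are encoded as functions `ε : Fin m → ℤˣ`. -/
theorem colinear_matrix_entry_count (N : ℕ) [NeZero N] (hN : 3 ≤ N) (hNodd : Odd N)
    (m : ℕ) (a : Fin m → ℤ) (z : ℤ) :
    (List.ofFn fun i => B N (((a i : ZMod N), 0))).prod ((z : ZMod N), 0) (0, 0) =
      ((Finset.univ.filter
          (fun ε : Fin m → ℤˣ =>
            ((∑ i : Fin m, (ε i : ℤ) * a i : ℤ) : ZMod N) = (z : ZMod N))).card : ℂ) := by
  exact colinear_prod_apply N m a z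
end
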